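/- Let G be a minimal non-mock-threshold graph on n > 5 vertices that is neither a cycle of length at least 5 nor the complement of such a cycle. Then the total number of vertices of G that are divalent (degree exactly 2) or co-divalent (degree exactly n−3) is at least n/2. -/

import Mathlib

/-- The degree of the `i`-th vertex of the ordering `v` within the prefix
`{v 0, …, v i}`, i.e. the number of earlier vertices adjacent to `v i`. -/
noncomputable def prefixDegree {n : ℕ} {V : Type*} (G : SimpleGraph V) (v : Fin n ≃ V)
    (i : Fin n) : ℕ :=
  Nat.card {j : Fin n // j < i ∧ G.Adj (v i) (v j)}

/-- A finite simple graph is mock threshold if there is an ordering `v 0, …, v (n-1)` of its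
vertices such that each `v i` has degree `0`, `1`, `(i+1)-2`, or `(i+1)-1` in the subgraph
induced on `{v 0, …, v i}` (a prefix of `i+1` vertices). -/
def IsMockThreshold {V : Type*} [Fintype V] (G : SimpleGraph V) : Prop :=
  ∃ v : Fin (Fintype.card V) ≃ V, ∀ i : Fin (Fintype.card V),
    prefixDegree G v i = 0 ∨ prefixDegree G v i = 1 ∨
    prefixDegree G v i = (i : ℕ) - 1 ∨ prefixDegree G v i = (i : ℕ)

/-- A graph is a minimal non-mock-threshold graph if it is not mock threshold but every
proper induced subgraph of it is mock threshold. -/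
def IsMinimalNonMockThreshold {V : Type*} [Fintype V] (G : SimpleGraph V) : Prop :=
  ¬ IsMockThreshold G ∧
    ∀ X : Finset V, X ≠ Finset.univ → IsMockThreshold (G.induce (X : Set V))

open Finset

/-- An ordering of the vertices by any `Fin n` witnesses the mock threshold property. -/
theorem IsMockThreshold.of_equiv {V : Type*} [Fintype V] {G : SimpleGraph V} {n : ℕ}
    (f : Fin n ≃ V) (h : ∀ i : Fin n, prefixDegree G f i = 0 ∨ prefixDegree G f i = 1 ∨
      prefixDegree G f i = (i : ℕ) - 1 ∨ prefixDegree G f i = (i : ℕ)) :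
    IsMockThreshold G := by
  obtain rfl : n = Fintype.card V := by simpa using Fintype.card_congr f
  exact ⟨f, h⟩

/-- The last vertex of an ordering has its full degree as prefix degree. -/
theorem prefixDegree_last {V : Type*} (G : SimpleGraph V) {m : ℕ} (f : Fin (m + 1) ≃ V) :
    prefixDegree G f (Fin.last m) = Nat.card (G.neighborSet (f (Fin.last m))) := by
  refine Nat.card_eq_of_bijective (fun j => ⟨f j.1, j.2.2⟩) ⟨?_, ?_⟩
  · rintro ⟨a, _⟩ ⟨b, _⟩ h
    exact Subtype.ext (f.injective (congrArg Subtype.val h))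
  · rintro ⟨y, hy⟩
    refine ⟨⟨f.symm y, ?_, ?_⟩, by simp⟩
    · refine lt_of_le_of_ne (Fin.le_last _) fun h => G.ne_of_adj hy ?_
      rw [← h, Equiv.apply_symm_apply]
    · simpa using hy

/-- If all vertices but `v` induce a mock threshold graph and `v` has degree `0`, `1`, `n - 2`
or `n - 1`, then the whole graph is mock threshold. -/
theorem IsMockThreshold.of_induce {V : Type*} [Fintype V] {G : SimpleGraph V}
    [DecidableRel G.Adj] {X : Finset V} {v : V} (hX : ∀ x, x ∈ X ↔ x ≠ v)
    (h : IsMockThreshold (G.induce (X : Set V)))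
    (hv : G.degree v = 0 ∨ G.degree v = 1 ∨ G.degree v = Fintype.card V - 2 ∨
      G.degree v = Fintype.card V - 1) :
    IsMockThreshold G := by
  obtain ⟨f, hf⟩ := h
  generalize Fintype.card (X : Set V) = m at f hf
  let g₀ : Fin (m + 1) → V := Fin.lastCases v (fun i => (f i : V))
  have g₀_last : g₀ (Fin.last m) = v := by simp [g₀]
  have g₀_castSucc : ∀ i : Fin m, g₀ i.castSucc = f i := fun i => by simp [g₀]
  have hne : ∀ i : Fin m, (f i : V) ≠ v := fun i => (hX _).1 (f i).2
  have hbij : Function.Bijective g₀ := by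
    constructor
    · intro a b hab
      induction a using Fin.lastCases with
      | last =>
        induction b using Fin.lastCases with
        | last => rfl
        | cast b => exact absurd (by rw [← g₀_castSucc, ← hab, g₀_last]) (hne b)
      | cast a =>
        induction b using Fin.lastCases with
        | last => exact absurd (by rw [← g₀_castSucc, hab, g₀_last]) (hne a)
        | cast b =>
          rw [g₀_castSucc, g₀_castSucc] at hab
          rw [f.injective (Subtype.ext hab)]
    · intro y
      by_cases hy : y = v
      · exact ⟨Fin.last m, by rw [g₀_last, hy]⟩
      · exact ⟨(f.symm ⟨y, (hX y).2 hy⟩).castSucc, by rw [g₀_castSucc]; simp⟩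
  let g : Fin (m + 1) ≃ V := Equiv.ofBijective g₀ hbij
  have hg_castSucc : ∀ i : Fin m, g i.castSucc = f i := g₀_castSucc
  have hcard : Fintype.card V = m + 1 := by simpa using (Fintype.card_congr g).symm
  refine IsMockThreshold.of_equiv g fun i => ?_
  induction i using Fin.lastCases with
  | last =>
    have hlast : prefixDegree G g (Fin.last m) = G.degree v := by
      rw [prefixDegree_last, show g (Fin.last m) = v from g₀_last, Nat.card_eq_fintype_card,
        G.card_neighborSet_eq_degree]
    rw [hlast, Fin.val_last]
    omega
  | cast i =>
    have hi : prefixDegree (G.induce (X : Set V)) f i = prefixDegree G g i.castSucc := by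
      refine Nat.card_eq_of_bijective
        (fun j => ⟨j.1.castSucc, Fin.castSucc_lt_castSucc_iff.2 j.2.1, by
          rw [hg_castSucc, hg_castSucc]; exact j.2.2⟩) ⟨?_, ?_⟩
      · rintro ⟨a, _⟩ ⟨b, _⟩ hab
        simpa using hab
      · rintro ⟨j, hj, hadj⟩
        induction j using Fin.lastCases with
        | last => exact absurd hj (not_lt.2 (Fin.le_last _))
        | cast j =>
          rw [hg_castSucc, hg_castSucc] at hadj
          exact ⟨⟨j, Fin.castSucc_lt_castSucc_iff.1 hj, hadj⟩, rfl⟩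
    rw [← hi]
    exact hf i

/-- If all vertices but `v` induce a nonempty mock threshold graph, then some other vertex `w` has
degree `0`, `1`, `n - 3` or `n - 2` in that subgraph. -/
theorem IsMockThreshold.exists_degree_of_induce {V : Type*} [Fintype V] [DecidableEq V]
    {G : SimpleGraph V} [DecidableRel G.Adj] {X : Finset V} {v : V} (hX : ∀ x, x ∈ X ↔ x ≠ v)
    (h : IsMockThreshold (G.induce (X : Set V))) (hcard : 1 < Fintype.card V) :
    ∃ w, w ≠ v ∧ (#((G.neighborFinset w).erase v) = 0 ∨ #((G.neighborFinset w).erase v) = 1 ∨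
      #((G.neighborFinset w).erase v) = Fintype.card V - 3 ∨
      #((G.neighborFinset w).erase v) = Fintype.card V - 2) := by
  obtain ⟨f, hf⟩ := h
  have hXcard : Fintype.card (X : Set V) = Fintype.card V - 2 + 1 := by
    obtain rfl : X = univ.erase v := by ext x; simp [hX]
    simp only [coe_sort_coe, Fintype.card_coe, card_erase_of_mem (mem_univ v), card_univ]
    omega
  generalize Fintype.card (X : Set V) = m at f hf hXcard
  subst hXcard
  set w := f (Fin.last _) with hw
  have hdeg : Nat.card ((G.induce (X : Set V)).neighborSet w) =
      #((G.neighborFinset w).erase v) := by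
    rw [← Nat.card_eq_finsetCard]
    refine Nat.card_eq_of_bijective
      (fun y => ⟨y.1.1, mem_erase.2 ⟨(hX _).1 y.1.2, (G.mem_neighborFinset _ _).2 y.2⟩⟩) ⟨?_, ?_⟩
    · rintro ⟨⟨a, _⟩, _⟩ ⟨⟨b, _⟩, _⟩ hab
      simpa using hab
    · rintro ⟨y, hy⟩
      rw [mem_erase, G.mem_neighborFinset] at hy
      exact ⟨⟨⟨y, (hX y).2 hy.1⟩, hy.2⟩, rfl⟩
  refine ⟨w, (hX _).1 w.2, ?_⟩
  have := hf (Fin.last _)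
  rw [prefixDegree_last, ← hw, hdeg, Fin.val_last] at this
  omega

theorem minimal_nonMockThreshold_many_divalent_or_codivalent {V : Type*} [Fintype V]
    (G : SimpleGraph V) [DecidableRel G.Adj] (hG : IsMinimalNonMockThreshold G)
    (hcard : 5 < Fintype.card V)
    (hcyc : ∀ n : ℕ, 5 ≤ n → ¬ Nonempty (G ≃g SimpleGraph.cycleGraph n))
    (hcocyc : ∀ n : ℕ, 5 ≤ n → ¬ Nonempty (G ≃g (SimpleGraph.cycleGraph n)ᶜ)) :
    Fintype.card V ≤ 2 * (Finset.univ.filter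
      (fun v : V => G.degree v = 2 ∨ G.degree v = Fintype.card V - 3)).card := by
  classical
  obtain ⟨hnot, hsub⟩ := hG
  have hX : ∀ v x : V, x ∈ univ.erase v ↔ x ≠ v := by simp
  have hind : ∀ v : V, IsMockThreshold (G.induce ((univ.erase v : Finset V) : Set V)) := fun v =>
    hsub _ fun h => notMem_erase v univ (by rw [h]; exact mem_univ v)
  have hdeg : ∀ v : V, 2 ≤ G.degree v ∧ G.degree v ≤ Fintype.card V - 3 := fun v => by
    have := G.degree_lt_card_verts v
    by_contra hv
    exact hnot (.of_induce (hX v) (hind v) (by omega))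
  set D := univ.filter fun v : V => G.degree v = 2 ∨ G.degree v = Fintype.card V - 3 with hD
  let N : V → Finset V := fun w =>
    if G.degree w = 2 then G.neighborFinset w else Gᶜ.neighborFinset w
  have hN : ∀ w ∈ D, #(N w) ≤ 2 := fun w hw => by
    by_cases h2 : G.degree w = 2
    · simp [N, h2]
    · have : G.degree w = Fintype.card V - 3 := (mem_filter.1 hw).2.resolve_left h2
      simp only [N, h2, if_false, SimpleGraph.card_neighborFinset_eq_degree,
        SimpleGraph.degree_compl]
      omega
  have hcover : univ ⊆ D.biUnion N := fun v _ => by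
    obtain ⟨w, hwv, hw⟩ := (hind v).exists_degree_of_induce (hX v) (by omega)
    have := hdeg w
    rw [mem_biUnion]
    by_cases hadj : G.Adj w v
    · rw [card_erase_of_mem (by simpa using hadj), G.card_neighborFinset_eq_degree] at hw
      have h2 : G.degree w = 2 := by omega
      exact ⟨w, by simp [hD, h2], by simpa [N, h2] using hadj⟩
    · rw [erase_eq_of_notMem (by simpa using hadj), G.card_neighborFinset_eq_degree] at hw
      have h3 : G.degree w = Fintype.card V - 3 := by omega
      have h2 : G.degree w ≠ 2 := by omega
      exact ⟨w, by simp [hD, h3], by simp [N, h2, hadj, hwv]⟩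
  calc Fintype.card V = #(univ : Finset V) := card_univ.symm
    _ ≤ #(D.biUnion N) := card_le_card hcover
    _ ≤ #D * 2 := card_biUnion_le_card_mul _ _ _ hN
    _ = 2 * #D := mul_comm _ _
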